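/- arXiv:2512.01070 — 11 statements merged into one kernel-verified Lean document; each statement's English description precedes it below -/
import Mathlib

section
/- Let p₁, p₂ ≥ 2 be integers, p = p₁p₂, and let r be an integer with p₁/p₂ + p₂/p₁ < r. Suppose C is a core covariance matrix and C = B·Bᵀ + λ·I_p for some real p×r matrix B of rank r and some real λ > 0. Then λ ∈ (0,1) and there exists a real p×r matrix A of rank r such that B·Bᵀ = (1−λ)·A·Aᵀ, tr₁(A·Aᵀ) = p₂·I_{p₁}, and tr₂(A·Aᵀ) = p₁·I_{p₂}. -/
open Matrix
open scoped Kronecker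

/-- Partial trace `tr₁` of a `p×p` matrix indexed by Kronecker pairs `(i,j)` with
`i ∈ Fin p₂`, `j ∈ Fin p₁`: `tr₁(M)_{jj'} = Σ_i M((i,j),(i,j'))`. -/
def partialTrace1 {p₁ p₂ : ℕ} (M : Matrix (Fin p₂ × Fin p₁) (Fin p₂ × Fin p₁) ℝ) :
    Matrix (Fin p₁) (Fin p₁) ℝ :=
  fun j j' => ∑ i : Fin p₂, M (i, j) (i, j')

/-- Partial trace `tr₂`: `tr₂(M)_{ii'} = Σ_j M((i,j),(i',j))`. -/
def partialTrace2 {p₁ p₂ : ℕ} (M : Matrix (Fin p₂ × Fin p₁) (Fin p₂ × Fin p₁) ℝ) :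
    Matrix (Fin p₂) (Fin p₂) ℝ :=
  fun i i' => ∑ j : Fin p₁, M (i, j) (i', j)

/-- a partial-isotropy core `C = BBᵀ + λ I` with `rank B = r`,
`λ > 0`, and `p₁/p₂ + p₂/p₁ < r` satisfies `λ ∈ (0,1)` and
`BBᵀ = (1-λ) AAᵀ` for a rank-`r` core `AAᵀ`. -/
theorem partial_isotropy_core_decomposition
    (p₁ p₂ r : ℕ) (hp₁ : 2 ≤ p₁) (hp₂ : 2 ≤ p₂)
    (hr : (p₁ : ℝ) / p₂ + (p₂ : ℝ) / p₁ < r)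
    (C : Matrix (Fin p₂ × Fin p₁) (Fin p₂ × Fin p₁) ℝ)
    (hCpd : C.PosDef)
    (hC1 : partialTrace1 C = (p₂ : ℝ) • (1 : Matrix (Fin p₁) (Fin p₁) ℝ))
    (hC2 : partialTrace2 C = (p₁ : ℝ) • (1 : Matrix (Fin p₂) (Fin p₂) ℝ))
    (B : Matrix (Fin p₂ × Fin p₁) (Fin r) ℝ) (hB : B.rank = r)
    (lam : ℝ) (hlam : 0 < lam)
    (hdecomp : C = B * Bᵀ + lam • 1) :
    lam ∈ Set.Ioo (0 : ℝ) 1 ∧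
      ∃ A : Matrix (Fin p₂ × Fin p₁) (Fin r) ℝ,
        A.rank = r ∧
        B * Bᵀ = (1 - lam) • (A * Aᵀ) ∧
        partialTrace1 (A * Aᵀ) = (p₂ : ℝ) • (1 : Matrix (Fin p₁) (Fin p₁) ℝ) ∧
        partialTrace2 (A * Aᵀ) = (p₁ : ℝ) • (1 : Matrix (Fin p₂) (Fin p₂) ℝ) := by
  have h1 : partialTrace1 (B * Bᵀ) = ((1 - lam) * p₂) • (1 : Matrix (Fin p₁) (Fin p₁) ℝ) := by
    ext j j'
    have h := congrFun (congrFun hC1 j) j'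
    rw [hdecomp] at h
    by_cases hj : j = j'
    · subst hj
      simp [partialTrace1, Finset.sum_add_distrib, Matrix.one_apply] at h ⊢
      linarith
    · simp [partialTrace1, Finset.sum_add_distrib, Matrix.one_apply, hj] at h ⊢
      linarith
  have h2 : partialTrace2 (B * Bᵀ) = ((1 - lam) * p₁) • (1 : Matrix (Fin p₂) (Fin p₂) ℝ) := by
    ext j j'
    have h := congrFun (congrFun hC2 j) j'
    rw [hdecomp] at h
    by_cases hj : j = j'
    · subst hj
      simp [partialTrace2, Finset.sum_add_distrib, Matrix.one_apply] at h ⊢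
      linarith
    · simp [partialTrace2, Finset.sum_add_distrib, Matrix.one_apply, hj] at h ⊢
      linarith
  have hlt : lam < 1 := by
    by_contra hcon
    have hge : 1 ≤ lam := not_lt.mp hcon
    have hB0 : B = 0 := by
      ext ⟨i, j⟩ k
      have h := congrFun (congrFun h1 j) j
      have hle : ∑ i : Fin p₂, ∑ k : Fin r, B (i, j) k * B (i, j) k ≤ 0 := by
        have h' : ∑ i : Fin p₂, ∑ k : Fin r, B (i, j) k * B (i, j) k = (1 - lam) * p₂ := by
          simpa [partialTrace1, Matrix.mul_apply] using h
        rw [h']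
        exact mul_nonpos_of_nonpos_of_nonneg (by linarith) (Nat.cast_nonneg _)
      have ha : ∑ k : Fin r, B (i, j) k * B (i, j) k ≤
          ∑ i : Fin p₂, ∑ k : Fin r, B (i, j) k * B (i, j) k :=
        Finset.single_le_sum (f := fun i => ∑ k : Fin r, B (i, j) k * B (i, j) k)
          (fun i _ => Finset.sum_nonneg fun k _ => mul_self_nonneg _) (Finset.mem_univ i)
      have hb : B (i, j) k * B (i, j) k ≤ ∑ k : Fin r, B (i, j) k * B (i, j) k :=
        Finset.single_le_sum (f := fun k => B (i, j) k * B (i, j) k)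
          (fun k _ => mul_self_nonneg _) (Finset.mem_univ k)
      have hc : B (i, j) k * B (i, j) k = 0 :=
        le_antisymm (by linarith) (mul_self_nonneg _)
      simpa using hc
    rw [hB0, Matrix.rank_zero] at hB
    rw [← hB] at hr
    have : (0 : ℝ) ≤ (p₁ : ℝ) / p₂ + (p₂ : ℝ) / p₁ := by positivity
    simp only [Nat.cast_zero] at hr
    linarith
  have hpos : 0 < 1 - lam := by linarith
  have hs : Real.sqrt (1 - lam) ≠ 0 := (Real.sqrt_pos.mpr hpos).ne'
  have hAA : ((Real.sqrt (1 - lam))⁻¹ • B) * ((Real.sqrt (1 - lam))⁻¹ • B)ᵀ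
      = (1 - lam)⁻¹ • (B * Bᵀ) := by
    rw [Matrix.transpose_smul, Matrix.smul_mul, Matrix.mul_smul, smul_smul, ← mul_inv,
      Real.mul_self_sqrt hpos.le]
  refine ⟨⟨hlam, hlt⟩, (Real.sqrt (1 - lam))⁻¹ • B, ?_, ?_, ?_, ?_⟩
  · exact (Matrix.rank_smul_of_mem_nonZeroDivisors B
      (mem_nonZeroDivisors_of_ne_zero (inv_ne_zero hs))).trans hB
  · rw [hAA, smul_smul, mul_inv_cancel₀ hpos.ne', one_smul]
  · rw [hAA]
    have : partialTrace1 ((1 - lam)⁻¹ • (B * Bᵀ)) = (1 - lam)⁻¹ • partialTrace1 (B * Bᵀ) := by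
      ext a b
      simp [partialTrace1, Finset.mul_sum]
    rw [this, h1, smul_smul, inv_mul_cancel_left₀ hpos.ne']
  · rw [hAA]
    have : partialTrace2 ((1 - lam)⁻¹ • (B * Bᵀ)) = (1 - lam)⁻¹ • partialTrace2 (B * Bᵀ) := by
      ext a b
      simp [partialTrace2, Finset.mul_sum]
    rw [this, h2, smul_smul, inv_mul_cancel_left₀ hpos.ne']
end

section
/- If K₁ is a p₁×p₁ real positive definite matrix and K₂ is a p₂×p₂ real positive definite matrix such that the Kronecker product K₂ ⊗ K₁ is a core covariance matrix, then K₂ ⊗ K₁ = I_p; that is, the only separable core covariance matrix is the identity. -/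
open Matrix
open scoped Kronecker

/-- the only separable core covariance matrix is the identity. -/
theorem separable_core_is_identity
    (p₁ p₂ : ℕ) (hp₁ : 2 ≤ p₁) (hp₂ : 2 ≤ p₂)
    (K₁ : Matrix (Fin p₁) (Fin p₁) ℝ) (K₂ : Matrix (Fin p₂) (Fin p₂) ℝ)
    (hK₁ : K₁.PosDef) (hK₂ : K₂.PosDef)
    (hcore1 : partialTrace1 (K₂ ⊗ₖ K₁) = (p₂ : ℝ) • (1 : Matrix (Fin p₁) (Fin p₁) ℝ))
    (hcore2 : partialTrace2 (K₂ ⊗ₖ K₁) = (p₁ : ℝ) • (1 : Matrix (Fin p₂) (Fin p₂) ℝ)) :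
    K₂ ⊗ₖ K₁ = (1 : Matrix (Fin p₂ × Fin p₁) (Fin p₂ × Fin p₁) ℝ) := by
  have h1 : ∀ j j', K₂.trace * K₁ j j' = (p₂ : ℝ) * (1 : Matrix (Fin p₁) (Fin p₁) ℝ) j j' := by
    intro j j'
    have h := congrFun (congrFun hcore1 j) j'
    simpa [partialTrace1, Matrix.trace, Finset.sum_mul, Matrix.smul_apply] using h
  have h2 : ∀ i i', K₂ i i' * K₁.trace = (p₁ : ℝ) * (1 : Matrix (Fin p₂) (Fin p₂) ℝ) i i' := by
    intro i i'
    have h := congrFun (congrFun hcore2 i) i'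
    simpa [partialTrace2, Matrix.trace, Finset.mul_sum, Matrix.smul_apply] using h
  have h3 : K₂.trace * K₁.trace = (p₂ : ℝ) * p₁ := by
    have : K₂.trace * K₁.trace = ∑ j, K₂.trace * K₁ j j := by
      rw [← Finset.mul_sum]; rfl
    rw [this, Finset.sum_congr rfl (fun j _ => h1 j j)]
    simp [mul_comm]
  have hp : (p₂ : ℝ) * p₁ ≠ 0 := by
    have a : p₁ ≠ 0 := by omega
    have b : p₂ ≠ 0 := by omega
    exact_mod_cast mul_ne_zero b a
  rw [← Matrix.one_kronecker_one]
  ext ⟨i, j⟩ ⟨i', j'⟩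
  rw [Matrix.kroneckerMap_apply, Matrix.kroneckerMap_apply]
  apply mul_left_cancel₀ hp
  have e1 := h1 j j'
  have e2 := h2 i i'
  calc (p₂ : ℝ) * p₁ * (K₂ i i' * K₁ j j')
      = (K₂.trace * K₁ j j') * (K₂ i i' * K₁.trace) := by rw [← h3]; ring
    _ = _ := by rw [e1, e2]; ring
end

section
/- Let L ∈ L_p^{++} and define, for lower triangular p×p real matrices V, the map P_L(V) = V − (tr(L⁻¹V)/p)·𝔻(L). Then: (i) for every lower triangular p×p matrix V, tr(L⁻¹·P_L(V)) = 0; and (ii) for every lower triangular p×p matrix V with tr(L⁻¹V) = 0, g^Chol_L(V, 𝔻(L)) = 0. Consequently P_L is the g^Chol-orthogonal projection of the space of lower triangular matrices onto the subspace {V lower triangular : tr(L⁻¹V) = 0}. -/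
open Matrix

noncomputable section

/-- The diagonal part `𝔻(M)` of a square matrix. -/
def diagPart {p : ℕ} (M : Matrix (Fin p) (Fin p) ℝ) : Matrix (Fin p) (Fin p) ℝ :=
  Matrix.diagonal (fun i => M i i)

/-- The strictly lower triangular part `⌊M⌋` of a square matrix. -/
def strictLower {p : ℕ} (M : Matrix (Fin p) (Fin p) ℝ) : Matrix (Fin p) (Fin p) ℝ :=
  fun i j => if j < i then M i j else 0

/-- A matrix is lower triangular: all entries strictly above the diagonal vanish. -/
def IsLowerTri {p : ℕ} (M : Matrix (Fin p) (Fin p) ℝ) : Prop :=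
  ∀ i j : Fin p, i < j → M i j = 0

/-- The Cholesky metric
`g^Chol_L(U,V) = tr(⌊U⌋ᵀ⌊V⌋) + tr(𝔻(L)⁻²·𝔻(U)·𝔻(V))`. -/
def cholMetric {p : ℕ} (L U V : Matrix (Fin p) (Fin p) ℝ) : ℝ :=
  ((strictLower U)ᵀ * strictLower V).trace +
    ((Matrix.diagonal fun i => ((L i i) ^ 2)⁻¹) * diagPart U * diagPart V).trace

/-- A product of lower triangular matrices has the product of the diagonals as diagonal. -/
theorem lowerTri_mul_diag {p : ℕ} {A B : Matrix (Fin p) (Fin p) ℝ}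
    (hA : IsLowerTri A) (hB : IsLowerTri B) (i : Fin p) : (A * B) i i = A i i * B i i := by
  rw [Matrix.mul_apply]
  refine Finset.sum_eq_single i (fun j _ hj => ?_) (by simp)
  rcases lt_or_gt_of_ne hj with h | h
  · rw [hB j i h, mul_zero]
  · rw [hA i j h, zero_mul]

theorem trace_inv_mul {p : ℕ} {L V : Matrix (Fin p) (Fin p) ℝ}
    (hLtri : IsLowerTri L) (hLdiag : ∀ i, 0 < L i i) (hV : IsLowerTri V) :
    (L⁻¹ * V).trace = ∑ i, V i i / L i i := by
  have hbt : L.BlockTriangular OrderDual.toDual := fun i j h => hLtri i j h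
  have hdet : IsUnit L.det := by
    rw [Matrix.det_of_lowerTriangular L hbt, isUnit_iff_ne_zero]
    exact Finset.prod_ne_zero_iff.mpr fun i _ => (hLdiag i).ne'
  have hinv : IsLowerTri L⁻¹ := by
    haveI := Matrix.invertibleOfIsUnitDet L hdet
    have h := Matrix.blockTriangular_inv_of_blockTriangular hbt
    exact fun i j hij => h hij
  refine Finset.sum_congr rfl fun i _ => ?_
  have h1 : L⁻¹ i i * L i i = 1 := by
    rw [← lowerTri_mul_diag hinv hLtri, Matrix.nonsing_inv_mul L hdet, Matrix.one_apply_eq]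
  rw [Matrix.diag_apply, lowerTri_mul_diag hinv hV, eq_div_iff (hLdiag i).ne']
  linear_combination V i i * h1

/-- `P_L(V) = V − (tr(L⁻¹V)/p)·𝔻(L)` is the `g^Chol`-orthogonal
projection onto the trace-free subspace `{V lower triangular : tr(L⁻¹V) = 0}`. -/
theorem chol_orthogonal_projection
    (p : ℕ) (L : Matrix (Fin p) (Fin p) ℝ)
    (hLtri : IsLowerTri L) (hLdiag : ∀ i, 0 < L i i) :
    (∀ V : Matrix (Fin p) (Fin p) ℝ, IsLowerTri V →
      ((L⁻¹ * (V - ((L⁻¹ * V).trace / p) • diagPart L)).trace = 0)) ∧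
    (∀ V : Matrix (Fin p) (Fin p) ℝ, IsLowerTri V → (L⁻¹ * V).trace = 0 →
      cholMetric L V (diagPart L) = 0) := by
  have hD : IsLowerTri (diagPart L) := fun i j h => Matrix.diagonal_apply_ne _ h.ne
  constructor
  · intro V hV
    have hDt : (L⁻¹ * diagPart L).trace = p := by
      rw [trace_inv_mul hLtri hLdiag hD]
      simp [diagPart, (hLdiag _).ne']
    rw [Matrix.mul_sub, Matrix.mul_smul, Matrix.trace_sub, Matrix.trace_smul, hDt, smul_eq_mul]
    rcases Nat.eq_zero_or_pos p with rfl | hp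
    · simp [Matrix.trace]
    · have : (p : ℝ) ≠ 0 := by exact_mod_cast hp.ne'
      field_simp
      ring
  · intro V hV h
    rw [trace_inv_mul hLtri hLdiag hV] at h
    have hs : strictLower (diagPart L) = 0 := by
      ext i j
      by_cases hij : j < i
      · simp [strictLower, diagPart, hij, Matrix.diagonal_apply_ne _ hij.ne']
      · simp [strictLower, hij]
    rw [cholMetric, hs, Matrix.mul_zero, Matrix.trace_zero, zero_add, ← h]
    simp only [diagPart, Matrix.diagonal_mul_diagonal, Matrix.trace_diagonal,
      Matrix.diagonal_apply_eq]
    refine Finset.sum_congr rfl fun i _ => ?_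
    have := (hLdiag i).ne'
    field_simp
end
end

section
/- Let p₁, p₂ ≥ 2 be integers, p = p₁p₂, and let A₁,…,A_p be linearly independent real p₁×p₂ matrices. Suppose V is a real symmetric p₁×p₁ matrix and W is a real symmetric p₂×p₂ matrix such that (V − (tr(V)/p₁)·I_{p₁})·Aᵢ = Aᵢ·(W − (tr(W)/p₂)·I_{p₂}) for every i ∈ {1,…,p}. Then V = (tr(V)/p₁)·I_{p₁} and W = (tr(W)/p₂)·I_{p₂}, i.e. V and W are scalar multiples of the identity. -/
open Matrix

/-- if a full basis `A₁,…,A_p` (`p = p₁p₂`) of `p₁×p₂` matrices is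
intertwined by the centered versions of symmetric matrices `V` and `W`, then
`V` and `W` are scalar multiples of the identity. -/
theorem intertwining_full_basis_scalar
    (p₁ p₂ : ℕ) (hp₁ : 2 ≤ p₁) (hp₂ : 2 ≤ p₂)
    (A : Fin (p₁ * p₂) → Matrix (Fin p₁) (Fin p₂) ℝ)
    (hA : LinearIndependent ℝ A)
    (V : Matrix (Fin p₁) (Fin p₁) ℝ) (hV : V.IsSymm)
    (W : Matrix (Fin p₂) (Fin p₂) ℝ) (hW : W.IsSymm)
    (h : ∀ i, (V - (V.trace / p₁) • (1 : Matrix (Fin p₁) (Fin p₁) ℝ)) * A i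
            = A i * (W - (W.trace / p₂) • (1 : Matrix (Fin p₂) (Fin p₂) ℝ))) :
    V = (V.trace / p₁) • (1 : Matrix (Fin p₁) (Fin p₁) ℝ) ∧
    W = (W.trace / p₂) • (1 : Matrix (Fin p₂) (Fin p₂) ℝ) := by
  have hp₁' : (p₁ : ℝ) ≠ 0 := by
    have : p₁ ≠ 0 := by omega
    exact_mod_cast this
  have htr : (V - (V.trace / p₁) • (1 : Matrix (Fin p₁) (Fin p₁) ℝ)).trace = 0 := by
    rw [Matrix.trace_sub, Matrix.trace_smul, Matrix.trace_one, Fintype.card_fin, smul_eq_mul,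
      div_mul_cancel₀ _ hp₁', sub_self]
  rw [← sub_eq_zero (a := V), ← sub_eq_zero (a := W)]
  generalize V - (V.trace / p₁) • (1 : Matrix (Fin p₁) (Fin p₁) ℝ) = B at *
  generalize W - (W.trace / p₂) • (1 : Matrix (Fin p₂) (Fin p₂) ℝ) = C at *
  have hspan : Submodule.span ℝ (Set.range A) = ⊤ := by
    apply hA.span_eq_top_of_card_eq_finrank'
    simp [Module.finrank_matrix]
  have hall : ∀ X : Matrix (Fin p₁) (Fin p₂) ℝ, B * X = X * C := by
    intro X
    have hX : X ∈ Submodule.span ℝ (Set.range A) := by rw [hspan]; trivial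
    induction hX using Submodule.span_induction with
    | mem x hx => obtain ⟨i, rfl⟩ := hx; exact h i
    | zero => simp
    | add x y _ _ hx hy => rw [Matrix.mul_add, Matrix.add_mul, hx, hy]
    | smul a x _ hx => rw [Matrix.mul_smul, Matrix.smul_mul, hx]
  have key : ∀ (i a : Fin p₁) (b j : Fin p₂),
      (if b = j then B i a else 0) = (if a = i then C b j else 0) := by
    intro i a b j
    have := congrFun (congrFun (hall (Matrix.single a b 1)) i) j
    simpa [Matrix.mul_apply, Matrix.single_apply, ite_and, Finset.sum_ite_eq] using this
  let a₀ : Fin p₁ := ⟨0, by omega⟩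
  let b₀ : Fin p₂ := ⟨0, by omega⟩
  have hd : ∀ a b, B a a = C b b := fun a b => by simpa using key a a b b
  have hc : C b₀ b₀ = 0 := by
    have h1 : B.trace = p₁ * C b₀ b₀ := by
      simp [Matrix.trace, fun a => hd a b₀]
    rw [htr] at h1
    exact (mul_eq_zero.mp h1.symm).resolve_left hp₁'
  have hB : ∀ a, B a a = 0 := fun a => (hd a b₀).trans hc
  constructor
  · ext i a
    by_cases hia : a = i
    · subst hia; exact hB a
    · simpa [hia] using key i a b₀ b₀
  · ext b j
    by_cases hbj : b = j
    · subst hbj; exact (hd a₀ b).symm.trans (hB a₀)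
    · simpa [hbj] using (key a₀ a₀ b j).symm
end

section
/- Let p₁, p₂ ≥ 2 be integers and p = p₁p₂. The real vector space of p×p real symmetric matrices W satisfying tr₁(W) = 0 (the p₁×p₁ zero matrix) and tr₂(W) = 0 (the p₂×p₂ zero matrix) has dimension binom(p+1,2) − binom(p₁+1,2) − binom(p₂+1,2) + 1. This space is the tangent space of the core covariance manifold at any of its points. -/
open Matrix

/-- The space of symmetric `p×p` matrices with vanishing partial traces: the
tangent space of the core covariance manifold at any of its points. -/
def coreTangentSpace (p₁ p₂ : ℕ) :
    Submodule ℝ (Matrix (Fin p₂ × Fin p₁) (Fin p₂ × Fin p₁) ℝ) where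
  carrier := {W | W.IsSymm ∧ partialTrace1 W = 0 ∧ partialTrace2 W = 0}
  add_mem' := by
    rintro W W' ⟨h1, h2, h3⟩ ⟨h1', h2', h3'⟩
    refine ⟨h1.add h1', ?_, ?_⟩
    · have : partialTrace1 (W + W') = partialTrace1 W + partialTrace1 W' := by
        ext j j'; simp [partialTrace1, Finset.sum_add_distrib]
      rw [this, h2, h2', add_zero]
    · have : partialTrace2 (W + W') = partialTrace2 W + partialTrace2 W' := by
        ext i i'; simp [partialTrace2, Finset.sum_add_distrib]
      rw [this, h3, h3', add_zero]
  zero_mem' := by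
    refine ⟨Matrix.isSymm_zero, ?_, ?_⟩
    · ext j j'; simp [partialTrace1]
    · ext i i'; simp [partialTrace2]
  smul_mem' := by
    rintro c W ⟨h1, h2, h3⟩
    refine ⟨?_, ?_, ?_⟩
    · unfold Matrix.IsSymm at h1 ⊢
      rw [Matrix.transpose_smul, h1]
    · have : partialTrace1 (c • W) = c • partialTrace1 W := by
        ext j j'; simp [partialTrace1, Finset.mul_sum]
      rw [this, h2, smul_zero]
    · have : partialTrace2 (c • W) = c • partialTrace2 W := by
        ext i i'; simp [partialTrace2, Finset.mul_sum]
      rw [this, h3, smul_zero]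

/-- The space of symmetric matrices. -/
def symMat (n : Type) : Submodule ℝ (Matrix n n ℝ) where
  carrier := {W | W.IsSymm}
  add_mem' := fun h h' => Matrix.IsSymm.add h h'
  zero_mem' := Matrix.isSymm_zero
  smul_mem' := fun c _ h => Matrix.IsSymm.smul h c

/-- Symmetric matrices are functions on unordered pairs. -/
def symMatEquiv (n : Type) : symMat n ≃ₗ[ℝ] (Sym2 n → ℝ) where
  toFun W := fun z => Sym2.lift ⟨fun i j => W.1 i j, fun i j => (W.2.apply i j).symm⟩ z
  invFun f := ⟨Matrix.of fun i j => f s(i, j), by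
    apply Matrix.IsSymm.ext
    intro i j
    simp [Sym2.eq_swap]⟩
  map_add' := by
    intro W W'
    ext z
    induction z with
    | _ i j => simp
  map_smul' := by
    intro c W
    ext z
    induction z with
    | _ i j => simp
  left_inv := by
    intro W
    ext i j
    simp
  right_inv := by
    intro f
    ext z
    induction z with
    | _ i j => simp

theorem finrank_symMat (n : Type) [Fintype n] [DecidableEq n] :
    Module.finrank ℝ (symMat n) = (Fintype.card n + 1).choose 2 := by
  rw [(symMatEquiv n).finrank_eq, Module.finrank_fintype_fun_eq_card, Sym2.card]

/-- Both partial traces, as a linear map on symmetric matrices. -/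
def traceMap (p₁ p₂ : ℕ) :
    symMat (Fin p₂ × Fin p₁) →ₗ[ℝ] symMat (Fin p₁) × symMat (Fin p₂) where
  toFun W := (⟨partialTrace1 W.1, Matrix.IsSymm.ext fun i j =>
      Finset.sum_congr rfl fun _ _ => W.2.apply _ _⟩,
    ⟨partialTrace2 W.1, Matrix.IsSymm.ext fun i j =>
      Finset.sum_congr rfl fun _ _ => W.2.apply _ _⟩)
  map_add' := by
    intro W W'
    ext i j <;> simp [partialTrace1, partialTrace2, Finset.sum_add_distrib]
  map_smul' := by
    intro c W
    ext i j <;> simp [partialTrace1, partialTrace2, Finset.mul_sum]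

/-- The difference of the traces. -/
def traceDiff (p₁ p₂ : ℕ) : symMat (Fin p₁) × symMat (Fin p₂) →ₗ[ℝ] ℝ where
  toFun AB := AB.1.1.trace - AB.2.1.trace
  map_add' := by
    intro a b
    simp [Matrix.trace_add]
    ring
  map_smul' := by
    intro c a
    simp [Matrix.trace_smul]
    ring

theorem core_eq (p₁ p₂ : ℕ) : coreTangentSpace p₁ p₂ =
    (LinearMap.ker (traceMap p₁ p₂)).map (symMat (Fin p₂ × Fin p₁)).subtype := by
  ext W
  constructor
  · rintro ⟨h1, h2, h3⟩
    refine ⟨⟨W, h1⟩, ?_, rfl⟩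
    exact Prod.ext (Subtype.ext h2) (Subtype.ext h3)
  · rintro ⟨W, h, rfl⟩
    have h' : traceMap p₁ p₂ W = 0 := h
    exact ⟨W.2, congrArg (fun x => x.1.1) h', congrArg (fun x => x.2.1) h'⟩

theorem range_eq (p₁ p₂ : ℕ) (hp₁ : 2 ≤ p₁) (hp₂ : 2 ≤ p₂) :
    LinearMap.range (traceMap p₁ p₂) = LinearMap.ker (traceDiff p₁ p₂) := by
  have h1 : (p₁ : ℝ) ≠ 0 := by
    have : p₁ ≠ 0 := by omega
    exact_mod_cast this
  have h2 : (p₂ : ℝ) ≠ 0 := by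
    have : p₂ ≠ 0 := by omega
    exact_mod_cast this
  ext AB
  constructor
  · rintro ⟨W, rfl⟩
    change (partialTrace1 W.1).trace - (partialTrace2 W.1).trace = 0
    rw [sub_eq_zero]
    simp only [Matrix.trace, Matrix.diag, partialTrace1, partialTrace2]
    exact Finset.sum_comm
  · obtain ⟨⟨A, hA⟩, ⟨B, hB⟩⟩ := AB
    intro h
    have h' : A.trace = B.trace := sub_eq_zero.mp h
    simp only [Matrix.trace, Matrix.diag] at h'
    refine ⟨⟨Matrix.of fun x y => (if x.1 = y.1 then A x.2 y.2 / p₂ else 0)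
      + (if x.2 = y.2 then B x.1 y.1 / p₁ else 0)
      - (if x.1 = y.1 then (if x.2 = y.2 then (∑ i, A i i) / (p₁ * p₂) else 0) else 0),
      ?_⟩, ?_⟩
    · apply Matrix.IsSymm.ext
      intro x y
      have a := hA.apply x.2 y.2
      have b := hB.apply x.1 y.1
      simp only [Matrix.of_apply, a, b, eq_comm (a := y.1), eq_comm (a := y.2)]
    · refine Prod.ext (Subtype.ext ?_) (Subtype.ext ?_)
      · ext i j
        simp only [traceMap, partialTrace1, LinearMap.coe_mk, AddHom.coe_mk, Matrix.of_apply,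
          if_true, Finset.sum_sub_distrib, Finset.sum_add_distrib, Finset.sum_const,
          Finset.card_univ, Fintype.card_fin, nsmul_eq_mul]
        by_cases hij : i = j
        · simp only [hij, if_true, ← Finset.sum_div, ← h', Finset.sum_const,
            Finset.card_univ, Fintype.card_fin, nsmul_eq_mul]
          field_simp
          ring
        · simp only [hij, if_false, Finset.sum_const_zero]
          field_simp
          ring
      · ext i j
        simp only [traceMap, partialTrace2, LinearMap.coe_mk, AddHom.coe_mk, Matrix.of_apply,
          if_true, Finset.sum_sub_distrib, Finset.sum_add_distrib, Finset.sum_const,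
          Finset.card_univ, Fintype.card_fin, nsmul_eq_mul]
        by_cases hij : i = j
        · simp only [hij, if_true, ← Finset.sum_div]
          field_simp
          ring
        · simp only [hij, if_false, Finset.sum_const_zero]
          field_simp
          ring

theorem traceDiff_surj (p₁ p₂ : ℕ) (hp₁ : 2 ≤ p₁) :
    LinearMap.range (traceDiff p₁ p₂) = ⊤ := by
  have h1 : (p₁ : ℝ) ≠ 0 := by
    have : p₁ ≠ 0 := by omega
    exact_mod_cast this
  rw [LinearMap.range_eq_top]
  intro c
  refine ⟨(⟨(c / p₁) • 1, Matrix.IsSymm.smul Matrix.isSymm_one _⟩, 0), ?_⟩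
  simp [traceDiff, h1]

/-- the dimension of the space of symmetric matrices with vanishing
partial traces is `C(p+1,2) − C(p₁+1,2) − C(p₂+1,2) + 1` where `p = p₁p₂`. -/
theorem coreTangentSpace_finrank (p₁ p₂ : ℕ) (hp₁ : 2 ≤ p₁) (hp₂ : 2 ≤ p₂) :
    (Module.finrank ℝ (coreTangentSpace p₁ p₂) : ℤ)
      = (p₁ * p₂ + 1).choose 2 - (p₁ + 1).choose 2 - (p₂ + 1).choose 2 + 1 := by
  have e1 := LinearMap.finrank_range_add_finrank_ker (traceMap p₁ p₂)
  have e2 := LinearMap.finrank_range_add_finrank_ker (traceDiff p₁ p₂)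
  rw [range_eq p₁ p₂ hp₁ hp₂] at e1
  rw [traceDiff_surj p₁ p₂ hp₁, finrank_top, Module.finrank_self, Module.finrank_prod] at e2
  rw [core_eq, Submodule.finrank_map_subtype_eq]
  simp only [finrank_symMat, Fintype.card_prod, Fintype.card_fin] at e1 e2
  rw [mul_comm p₁ p₂]
  omega
end

section
/- Let α, β, r be real numbers with α ≥ 2, β ≥ 2, and r > α/β + β/α. Then for all real a ∈ [1, α−1] and b ∈ [1, β−1], it holds that a(α−a) + b(β−b) + r(ab + (α−a)(β−b)) < r·α·β. -/
/-- for `α, β ≥ 2` and `r > α/β + β/α`, the quantity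
`a(α−a) + b(β−b) + r(ab + (α−a)(β−b))` is strictly below `rαβ` for all
`a ∈ [1, α−1]`, `b ∈ [1, β−1]`. -/
theorem decomposable_dimension_bound
    (α β r : ℝ) (hα : 2 ≤ α) (hβ : 2 ≤ β) (hr : α / β + β / α < r) :
    ∀ a b : ℝ, a ∈ Set.Icc 1 (α - 1) → b ∈ Set.Icc 1 (β - 1) →
      a * (α - a) + b * (β - b) + r * (a * b + (α - a) * (β - b)) < r * α * β := by
  rintro a b ⟨ha, ha'⟩ ⟨hb, hb'⟩
  obtain ⟨c, rfl⟩ : ∃ c, α = a + c := ⟨α - a, by ring⟩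
  obtain ⟨d, rfl⟩ : ∃ d, β = b + d := ⟨β - b, by ring⟩
  have hc : 1 ≤ c := by linarith
  have hd : 1 ≤ d := by linarith
  have a0 : 0 < a := by linarith
  have b0 : 0 < b := by linarith
  have c0 : 0 < c := by linarith
  have d0 : 0 < d := by linarith
  have hS : 0 < a * d + c * b := by positivity
  have h1 : a * c ≤ (a + c) / (b + d) * (a * d + c * b) := by
    rw [div_mul_eq_mul_div, le_div_iff₀ (by positivity)]
    have : 0 ≤ a ^ 2 * d + c ^ 2 * b := by positivity
    linarith
  have h2 : b * d ≤ (b + d) / (a + c) * (a * d + c * b) := by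
    rw [div_mul_eq_mul_div, le_div_iff₀ (by positivity)]
    have : 0 ≤ b ^ 2 * c + d ^ 2 * a := by positivity
    linarith
  have h3 := mul_lt_mul_of_pos_right hr hS
  rw [add_mul] at h3
  have e1 : a + c - a = c := by ring
  have e2 : b + d - b = d := by ring
  rw [e1, e2]
  linarith
end

section
/- Fix integers p₁, p₂ ≥ 2 and an integer r with p₁/p₂ + p₂/p₁ < r ≤ p₁p₂. The set of canonically decomposable r-tuples of real p₁×p₂ matrices has Lebesgue measure zero in the product space of r-tuples of real p₁×p₂ matrices (identified with ℝ^{p₁p₂r}). -/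
open Matrix MeasureTheory

noncomputable instance {m n : Type*} [Fintype m] [Fintype n] : MeasureSpace (Matrix m n ℝ) :=
  inferInstanceAs (MeasureSpace (m → n → ℝ))

/-- A tuple `(A₁,…,A_r)` of real `p₁×p₂` matrices is canonically decomposable
if there exist `P ∈ GL(p₁,ℝ)`, `Q ∈ GL(p₂,ℝ)` and block sizes `1 ≤ a ≤ p₁−1`,
`1 ≤ b ≤ p₂−1` such that every `P·Aᵢ·Q⁻¹` has a (non-trivial) block-diagonal
zero pattern with blocks of sizes `a×b` and `(p₁−a)×(p₂−b)` (0-based indexing: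
the entry `(j,k)` vanishes whenever `j < a ∧ b ≤ k` or `a ≤ j ∧ k < b`). -/
def CanonicallyDecomposable (p₁ p₂ r : ℕ)
    (A : Fin r → Matrix (Fin p₁) (Fin p₂) ℝ) : Prop :=
  ∃ (P : Matrix (Fin p₁) (Fin p₁) ℝ) (Q : Matrix (Fin p₂) (Fin p₂) ℝ),
    IsUnit P ∧ IsUnit Q ∧
    ∃ a b : ℕ, 1 ≤ a ∧ a ≤ p₁ - 1 ∧ 1 ≤ b ∧ b ≤ p₂ - 1 ∧
      ∀ (i : Fin r) (j : Fin p₁) (k : Fin p₂),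
        (((j : ℕ) < a ∧ b ≤ (k : ℕ)) ∨ (a ≤ (j : ℕ) ∧ (k : ℕ) < b)) →
          (P * A i * Q⁻¹) j k = 0

/-- A matrix with a right inverse has an invertible maximal minor, normalised to the identity. -/
lemma exists_normalised {m n : Type} [Fintype m] [Fintype n] [DecidableEq m] [DecidableEq n]
    (R : Matrix m n ℝ) (S : Matrix n m ℝ) (h : R * S = 1) :
    ∃ (σ : m ↪ n) (N : Matrix m m ℝ), ∀ s s', (N * R) s (σ s') = if s = s' then 1 else 0 := by
  obtain ⟨κ, a, ha, hsp, hli⟩ := exists_linearIndependent' ℝ (fun j : n => R.col j)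
  have htop : Submodule.span ℝ (Set.range (fun j : n => R.col j)) = ⊤ := by
    rw [eq_top_iff]
    intro v _
    have hv : v = R *ᵥ (S *ᵥ v) := by rw [mulVec_mulVec, h, one_mulVec]
    rw [hv]
    have := Matrix.range_mulVecLin R
    change _ ∈ Submodule.span ℝ (Set.range R.col)
    rw [← this]
    exact ⟨S *ᵥ v, rfl⟩
  let B : Module.Basis κ ℝ (m → ℝ) := Module.Basis.mk hli (by rw [hsp, htop])
  haveI : Finite κ := Finite.of_injective a ha
  haveI : Fintype κ := Fintype.ofFinite κ
  let e : m ≃ κ := (Pi.basisFun ℝ m).indexEquiv B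
  let M : Matrix m m ℝ := R.submatrix id (a ∘ e)
  have hM : IsUnit M := by
    rw [← Matrix.linearIndependent_cols_iff_isUnit]
    exact hli.comp e e.injective
  refine ⟨⟨a ∘ e, ha.comp e.injective⟩, M⁻¹, ?_⟩
  intro s s'
  have h1 : M⁻¹ * M = 1 := Matrix.nonsing_inv_mul M ((Matrix.isUnit_iff_isUnit_det M).1 hM)
  have h2 := congrFun (congrFun h1 s) s'
  rw [Matrix.one_apply] at h2
  rw [← h2]
  rfl

/-- The range of a smooth map from a lower-dimensional space is a null set. -/
lemma null_range {E F : Type*} [NormedAddCommGroup E] [NormedSpace ℝ E] [FiniteDimensional ℝ E]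
    [NormedAddCommGroup F] [NormedSpace ℝ F] [FiniteDimensional ℝ F] [MeasurableSpace F]
    [BorelSpace F] (μ : Measure F) [μ.IsAddHaarMeasure] (f : E → F) (hf : ContDiff ℝ 1 f)
    (h : Module.finrank ℝ E < Module.finrank ℝ F) : μ (Set.range f) = 0 := by
  have h1 : μ ≪ Measure.hausdorffMeasure (X := F) ((Module.finrank ℝ F : NNReal) : ℝ) := by
    have := isAddHaarMeasure_hausdorffMeasure (E := F)
    simp only [NNReal.coe_natCast]
    exact Measure.absolutelyContinuous_isAddHaarMeasure _ _
  refine measure_zero_of_dimH_lt h1 (lt_of_le_of_lt hf.dimH_range_le ?_)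
  exact_mod_cast h

section param

variable {p₁ p₂ r : ℕ} {m l : Type} [Fintype m] [Fintype l] [DecidableEq m] [DecidableEq l]

/-- Parameter space for tuples with a prescribed zero block after base change. -/
abbrev ParamSpace (r : ℕ) (σ : m ↪ Fin p₁) (τ : l ↪ Fin p₂) : Type :=
  (m → {j // j ∉ Set.range σ} → ℝ) × ({k // k ∉ Set.range τ} → l → ℝ) ×
    (Fin r → {x : Fin p₁ × Fin p₂ // ¬ (x.1 ∈ Set.range σ ∧ x.2 ∈ Set.range τ)} → ℝ)

open Classical in
/-- Row coefficients completed by an identity block. -/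
noncomputable def fullG {n : ℕ} (σ : m ↪ Fin n) (g : m → {j // j ∉ Set.range σ} → ℝ)
    (s : m) (j : Fin n) : ℝ :=
  if h : j ∈ Set.range σ then (if σ s = j then 1 else 0) else g s ⟨j, h⟩

open Classical in
/-- Column coefficients completed by an identity block. -/
noncomputable def fullH {n : ℕ} (τ : l ↪ Fin n) (g : {j // j ∉ Set.range τ} → l → ℝ)
    (k : Fin n) (t : l) : ℝ :=
  if h : k ∈ Set.range τ then (if τ t = k then 1 else 0) else g ⟨k, h⟩ t

open Classical in
/-- The parametrisation. -/
noncomputable def paramMap (σ : m ↪ Fin p₁) (τ : l ↪ Fin p₂) (x : ParamSpace r σ τ) :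
    Fin r → Fin p₁ → Fin p₂ → ℝ := fun i j k =>
  if h : j ∈ Set.range σ ∧ k ∈ Set.range τ then
    - ∑ y : {x : Fin p₁ × Fin p₂ // ¬ (x.1 ∈ Set.range σ ∧ x.2 ∈ Set.range τ)},
      fullG σ x.1 h.1.choose y.1.1 * x.2.2 i y * fullH τ x.2.1 y.1.2 h.2.choose
  else x.2.2 i ⟨(j, k), h⟩

lemma contDiff_paramMap (σ : m ↪ Fin p₁) (τ : l ↪ Fin p₂) :
    ContDiff ℝ 1 (paramMap (r := r) σ τ) := by
  have hG : ∀ s j, ContDiff ℝ 1 (fun x : ParamSpace r σ τ => fullG σ x.1 s j) := by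
    intro s j
    unfold fullG
    split_ifs <;> fun_prop
  have hH : ∀ k t, ContDiff ℝ 1 (fun x : ParamSpace r σ τ => fullH τ x.2.1 k t) := by
    intro s j
    unfold fullH
    split_ifs <;> fun_prop
  rw [contDiff_pi]; intro i
  rw [contDiff_pi]; intro j
  rw [contDiff_pi]; intro k
  unfold paramMap
  split_ifs with h
  · refine ContDiff.neg (ContDiff.sum fun y _ => ?_)
    exact ((hG _ _).mul (by fun_prop)).mul (hH _ _)
  · fun_prop

lemma card_not_range {α n : Type} [Fintype α] [Fintype n] (σ : α ↪ n)
    [Fintype {j // j ∉ Set.range σ}] :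
    Fintype.card {j // j ∉ Set.range σ} = Fintype.card n - Fintype.card α := by
  classical
  rw [Fintype.card_subtype_compl]
  congr 1
  exact (Fintype.card_congr (Equiv.ofInjective σ σ.injective)).symm

lemma finrank_lt (σ : m ↪ Fin p₁) (τ : l ↪ Fin p₂)
    (h : Fintype.card m * (p₁ - Fintype.card m) + Fintype.card l * (p₂ - Fintype.card l)
      < r * (Fintype.card m * Fintype.card l)) :
    Module.finrank ℝ (ParamSpace r σ τ) <
      Module.finrank ℝ (Fin r → Fin p₁ → Fin p₂ → ℝ) := by
  classical
  have h1 := card_not_range σ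
  have h2 := card_not_range τ
  let ρ : m × l ↪ Fin p₁ × Fin p₂ := σ.prodMap τ
  have h3 : Fintype.card {x : Fin p₁ × Fin p₂ // ¬ (x.1 ∈ Set.range σ ∧ x.2 ∈ Set.range τ)}
      = p₁ * p₂ - Fintype.card m * Fintype.card l := by
    have := card_not_range ρ
    simp only [Fintype.card_prod, Fintype.card_fin] at this
    rw [← this]
    refine Fintype.card_congr (Equiv.subtypeEquivRight ?_)
    intro x
    have : x ∈ Set.range ρ ↔ (x.1 ∈ Set.range σ ∧ x.2 ∈ Set.range τ) := by
      constructor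
      · rintro ⟨y, rfl⟩
        exact ⟨⟨y.1, rfl⟩, ⟨y.2, rfl⟩⟩
      · rintro ⟨⟨s, hs⟩, ⟨t, ht⟩⟩
        exact ⟨(s, t), Prod.ext hs ht⟩
    rw [this]
  have h4 : Fintype.card m * Fintype.card l ≤ p₁ * p₂ := by
    simpa using Fintype.card_le_of_embedding ρ
  have h5 : Module.finrank ℝ (ParamSpace r σ τ) =
      Fintype.card m * (p₁ - Fintype.card m) + ((p₂ - Fintype.card l) * Fintype.card l +
        r * (p₁ * p₂ - Fintype.card m * Fintype.card l)) := by
    rw [Fintype.card_fin] at h1 h2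
    rw [Module.finrank_prod, Module.finrank_prod]
    simp only [Module.finrank_pi_fintype, Module.finrank_self, mul_one, Finset.sum_const, Finset.card_univ, smul_eq_mul,
      Fintype.card_fin, h3, h1, h2]
  have h6 : Module.finrank ℝ (Fin r → Fin p₁ → Fin p₂ → ℝ) = r * (p₁ * p₂) := by
    simp [Module.finrank_pi_fintype]
  rw [h5, h6]
  obtain ⟨q, hq⟩ := Nat.exists_eq_add_of_le h4
  rw [hq, Nat.add_sub_cancel_left, mul_add, mul_comm (p₂ - _)]
  omega

/-- Tuples with a common zero block of size `m × l` (after base change) lie in finitely many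
ranges. -/
lemma mem_range_paramMap (σ : m ↪ Fin p₁) (τ : l ↪ Fin p₂) (A : Fin r → Fin p₁ → Fin p₂ → ℝ)
    (G : Matrix m (Fin p₁) ℝ) (H : Matrix (Fin p₂) l ℝ)
    (hG : ∀ s s', G s (σ s') = if s = s' then 1 else 0)
    (hH : ∀ t t', H (τ t') t = if t = t' then 1 else 0)
    (h : ∀ i s t, ∑ x : Fin p₁ × Fin p₂, G s x.1 * A i x.1 x.2 * H x.2 t = 0) :
    A ∈ Set.range (paramMap (r := r) σ τ) := by
  classical
  refine ⟨⟨fun s j => G s j, fun k t => H k t, fun i y => A i y.1.1 y.1.2⟩, ?_⟩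
  have hfG : ∀ s j, fullG σ (fun s j => G s j) s j = G s j := by
    intro s j
    unfold fullG
    split_ifs with h1 h2 h2
    · rw [← h2, hG]; simp
    · obtain ⟨s', rfl⟩ := h1
      rw [hG, if_neg]
      rintro rfl; exact h2 rfl
    · rfl
  have hfH : ∀ k t, fullH τ (fun k t => H k t) k t = H k t := by
    intro k t
    unfold fullH
    split_ifs with h1 h2 h2
    · rw [← h2, hH]; simp
    · obtain ⟨s', rfl⟩ := h1
      rw [hH, if_neg]
      rintro rfl; exact h2 rfl
    · rfl
  funext i j k
  unfold paramMap
  split_ifs with hjk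
  · obtain ⟨h1, h2⟩ := hjk
    simp only [hfG, hfH]
    have e1 : σ h1.choose = j := h1.choose_spec
    have e2 : τ h2.choose = k := h2.choose_spec
    generalize h1.choose = s at *
    generalize h2.choose = t at *
    subst e1 e2
    have h3 := h i s t
    rw [← Fintype.sum_subtype_add_sum_subtype
      (fun x : Fin p₁ × Fin p₂ => x.1 ∈ Set.range σ ∧ x.2 ∈ Set.range τ)] at h3
    have h4 : ∑ x : {x : Fin p₁ × Fin p₂ // x.1 ∈ Set.range σ ∧ x.2 ∈ Set.range τ},
        G s x.1.1 * A i x.1.1 x.1.2 * H x.1.2 t = A i (σ s) (τ t) := by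
      rw [Finset.sum_eq_single ⟨(σ s, τ t), h1, h2⟩]
      · simp [hG, hH]
      · rintro ⟨⟨x, y⟩, ⟨s', hs⟩, ⟨t', ht⟩⟩ _ hne
        simp only at hs ht
        subst hs ht
        simp only [hG, hH]
        by_cases hs : s = s'
        · by_cases ht : t = t'
          · subst hs ht; exact absurd rfl hne
          · simp [ht]
        · simp [hs]
      · simp
    rw [h4] at h3
    linarith
  · rfl

lemma null_core
    (h : Fintype.card m * (p₁ - Fintype.card m) + Fintype.card l * (p₂ - Fintype.card l)
      < r * (Fintype.card m * Fintype.card l)) :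
    volume {A : Fin r → Fin p₁ → Fin p₂ → ℝ |
      ∃ (R : Matrix m (Fin p₁) ℝ) (S : Matrix (Fin p₁) m ℝ) (C : Matrix (Fin p₂) l ℝ)
        (D : Matrix l (Fin p₂) ℝ), R * S = 1 ∧ D * C = 1 ∧
          ∀ i, R * (Matrix.of (A i)) * C = 0} = 0 := by
  have hnull : volume (⋃ (σ : m ↪ Fin p₁) (τ : l ↪ Fin p₂),
      Set.range (paramMap (r := r) σ τ)) = 0 := by
    rw [measure_iUnion_null_iff]; intro σ
    rw [measure_iUnion_null_iff]; intro τ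
    have i1 : (volume : Measure (Fin p₂ → ℝ)).IsAddHaarMeasure := inferInstance
    have i2 : (volume : Measure (Fin p₁ → Fin p₂ → ℝ)).IsAddHaarMeasure :=
      inferInstanceAs (Measure.pi fun _ : Fin p₁ =>
        (volume : Measure (Fin p₂ → ℝ))).IsAddHaarMeasure
    have i3 : (volume : Measure (Fin r → Fin p₁ → Fin p₂ → ℝ)).IsAddHaarMeasure :=
      Measure.pi.isAddHaarMeasure _
    exact null_range _ _ (contDiff_paramMap σ τ) (finrank_lt σ τ h)
  refine measure_mono_null ?_ hnull
  rintro A ⟨R, S, C, D, hRS, hDC, hA⟩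
  obtain ⟨σ, N, hN⟩ := exists_normalised R S hRS
  obtain ⟨τ, M, hM⟩ := exists_normalised Cᵀ Dᵀ (by rw [← transpose_mul, hDC, transpose_one])
  simp only [Set.mem_iUnion]
  refine ⟨σ, τ, mem_range_paramMap σ τ A (N * R) (C * Mᵀ) hN ?_ ?_⟩
  · intro t t'
    rw [← hM t t', ← transpose_apply (M * Cᵀ), transpose_mul, transpose_transpose]
  · intro i s t
    have h1 : (N * R) * Matrix.of (A i) * (C * Mᵀ) = 0 := by
      have : (N * R) * Matrix.of (A i) * (C * Mᵀ) = N * (R * Matrix.of (A i) * C) * Mᵀ := by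
        simp only [Matrix.mul_assoc]
      rw [this, hA i]; simp
    have h2 := congrFun (congrFun h1 s) t
    rw [Matrix.mul_apply] at h2
    simp only [Matrix.mul_apply (M := N * R), Finset.sum_mul] at h2
    rw [Finset.sum_comm, ← Fintype.sum_prod_type'] at h2
    exact h2

end param

lemma num_lemma (p₁ p₂ r m c l d : ℕ) (hp₁ : 0 < p₁) (hp₂ : 0 < p₂)
    (hr : (p₁ : ℝ) / p₂ + (p₂ : ℝ) / p₁ < r) (hm : 0 < m) (hl : 0 < l)
    (h1 : m + c = p₁) (h2 : l + d = p₂) (h : c * p₂ ≤ l * p₁) :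
    m * (p₁ - m) + l * (p₂ - l) < r * (m * l) := by
  have e1 : p₁ - m = c := by omega
  have e2 : p₂ - l = d := by omega
  rw [e1, e2]
  have h' : d * p₁ ≤ m * p₂ := by
    rw [← h1, ← h2] at *
    nlinarith
  have hp₁' : (0 : ℝ) < p₁ := by exact_mod_cast hp₁
  have hp₂' : (0 : ℝ) < p₂ := by exact_mod_cast hp₂
  have hm' : (0 : ℝ) < m := by exact_mod_cast hm
  have hl' : (0 : ℝ) < l := by exact_mod_cast hl
  have a1 : (c : ℝ) ≤ l * (p₁ / p₂) := by
    rw [← mul_div_assoc, le_div_iff₀ hp₂']; exact_mod_cast h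
  have a2 : (d : ℝ) ≤ m * (p₂ / p₁) := by
    rw [← mul_div_assoc, le_div_iff₀ hp₁']; exact_mod_cast h'
  have : (m : ℝ) * c + l * d < r * (m * l) := by
    have b1 := mul_le_mul_of_nonneg_left a1 hm'.le
    have b2 := mul_le_mul_of_nonneg_left a2 hl'.le
    have b3 := mul_lt_mul_of_pos_right hr (mul_pos hm' hl')
    nlinarith
  exact_mod_cast this

/-- Extract the zero block condition for chosen rows and columns. -/
lemma block_extract {p₁ p₂ r : ℕ} (f : Fin p₁ → Prop) (g : Fin p₂ → Prop)
    [DecidablePred f] [DecidablePred g]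
    (A : Fin r → Matrix (Fin p₁) (Fin p₂) ℝ)
    (P : Matrix (Fin p₁) (Fin p₁) ℝ) (Q : Matrix (Fin p₂) (Fin p₂) ℝ)
    (hP : IsUnit P) (hQ : IsUnit Q)
    (h : ∀ i j k, f j → g k → (P * A i * Q⁻¹) j k = 0) :
    ∃ (R : Matrix {j // f j} (Fin p₁) ℝ) (S : Matrix (Fin p₁) {j // f j} ℝ)
      (C : Matrix (Fin p₂) {k // g k} ℝ) (D : Matrix {k // g k} (Fin p₂) ℝ),
      R * S = 1 ∧ D * C = 1 ∧ ∀ i, R * (Matrix.of (A i)) * C = 0 := by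
  have hP1 : P * P⁻¹ = 1 := Matrix.mul_nonsing_inv P ((Matrix.isUnit_iff_isUnit_det P).1 hP)
  have hQ1 : Q * Q⁻¹ = 1 := Matrix.mul_nonsing_inv Q ((Matrix.isUnit_iff_isUnit_det Q).1 hQ)
  refine ⟨P.submatrix Subtype.val id, P⁻¹.submatrix id Subtype.val,
    Q⁻¹.submatrix id Subtype.val, Q.submatrix Subtype.val id, ?_, ?_, ?_⟩
  · rw [← Matrix.submatrix_mul _ _ _ _ _ Function.bijective_id, hP1,
      Matrix.submatrix_one _ Subtype.val_injective]
  · rw [← Matrix.submatrix_mul _ _ _ _ _ Function.bijective_id, hQ1,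
      Matrix.submatrix_one _ Subtype.val_injective]
  · intro i
    ext s t
    exact h i s t s.2 t.2

lemma card_lt_sub {n a : ℕ} (h : a ≤ n) : Fintype.card {j : Fin n // (j : ℕ) < a} = a := by
  rw [Fintype.card_subtype]
  simpa [h] using Fin.card_filter_val_lt (n := n) (m := a)

lemma card_ge_sub {n a : ℕ} (h : a ≤ n) : Fintype.card {j : Fin n // a ≤ (j : ℕ)} = n - a := by
  have h1 := Fintype.card_subtype_compl (fun j : Fin n => (j : ℕ) < a)
  rw [card_lt_sub h, Fintype.card_fin] at h1
  rw [← h1]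
  exact Fintype.card_congr (Equiv.subtypeEquivRight fun x => not_lt.symm)

/-- for `p₁/p₂ + p₂/p₁ < r ≤ p₁p₂`, the set of canonically
decomposable `r`-tuples has Lebesgue measure zero. -/
theorem canonicallyDecomposable_measure_zero (p₁ p₂ r : ℕ)
    (hp₁ : 2 ≤ p₁) (hp₂ : 2 ≤ p₂)
    (hrlow : (p₁ : ℝ) / p₂ + (p₂ : ℝ) / p₁ < r) (hrhigh : r ≤ p₁ * p₂) :
    volume {A : Fin r → Matrix (Fin p₁) (Fin p₂) ℝ |
      CanonicallyDecomposable p₁ p₂ r A} = 0 := by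
  have key : ∀ a b : ℕ, volume {A : Fin r → Fin p₁ → Fin p₂ → ℝ |
      (1 ≤ a ∧ a ≤ p₁ - 1 ∧ 1 ≤ b ∧ b ≤ p₂ - 1) ∧
      ∃ (P : Matrix (Fin p₁) (Fin p₁) ℝ) (Q : Matrix (Fin p₂) (Fin p₂) ℝ),
        IsUnit P ∧ IsUnit Q ∧ ∀ (i : Fin r) (j : Fin p₁) (k : Fin p₂),
        (((j : ℕ) < a ∧ b ≤ (k : ℕ)) ∨ (a ≤ (j : ℕ) ∧ (k : ℕ) < b)) →
          (P * Matrix.of (A i) * Q⁻¹) j k = 0} = 0 := by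
    intro a b
    by_cases hab : 1 ≤ a ∧ a ≤ p₁ - 1 ∧ 1 ≤ b ∧ b ≤ p₂ - 1
    swap
    · simp [hab]
    obtain ⟨ha1, ha2, hb1, hb2⟩ := hab
    rcases le_total (a * p₂) (b * p₁) with hle | hle
    · refine measure_mono_null ?_ (null_core (p₁ := p₁) (p₂ := p₂) (r := r)
        (m := {j : Fin p₁ // a ≤ (j : ℕ)}) (l := {k : Fin p₂ // (k : ℕ) < b}) ?_)
      · rintro A ⟨-, P, Q, hP, hQ, h⟩
        exact block_extract (fun j : Fin p₁ => a ≤ (j : ℕ)) (fun k : Fin p₂ => (k : ℕ) < b)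
          (fun i => Matrix.of (A i)) P Q hP hQ (fun i j k hj hk => h i j k (Or.inr ⟨hj, hk⟩))
      · rw [card_ge_sub (by omega), card_lt_sub (by omega)]
        exact num_lemma p₁ p₂ r (p₁ - a) a b (p₂ - b) (by omega) (by omega) hrlow (by omega)
          (by omega) (by omega) (by omega) hle
    · refine measure_mono_null ?_ (null_core (p₁ := p₁) (p₂ := p₂) (r := r)
        (m := {j : Fin p₁ // (j : ℕ) < a}) (l := {k : Fin p₂ // b ≤ (k : ℕ)}) ?_)
      · rintro A ⟨-, P, Q, hP, hQ, h⟩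
        exact block_extract (fun j : Fin p₁ => (j : ℕ) < a) (fun k : Fin p₂ => b ≤ (k : ℕ))
          (fun i => Matrix.of (A i)) P Q hP hQ (fun i j k hj hk => h i j k (Or.inl ⟨hj, hk⟩))
      · rw [card_ge_sub (by omega), card_lt_sub (by omega)]
        refine num_lemma p₁ p₂ r a (p₁ - a) (p₂ - b) b (by omega) (by omega) hrlow (by omega)
          (by omega) (by omega) (by omega) ?_
        rw [Nat.sub_mul, Nat.sub_mul, mul_comm p₂ p₁]
        omega
  have hnull := measure_iUnion_null (fun a => measure_iUnion_null (fun b => key a b))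
  refine measure_mono_null (μ := (volume : Measure (Fin r → Fin p₁ → Fin p₂ → ℝ))) ?_ hnull
  rintro A ⟨P, Q, hP, hQ, a, b, h1, h2, h3, h4, h⟩
  simp only [Set.mem_iUnion]
  exact ⟨a, b, ⟨h1, h2, h3, h4⟩, P, Q, hP, hQ, h⟩
end

section
/- Let L₁ be a p₁×p₁ and L₂ a p₂×p₂ real lower triangular matrix with positive diagonal entries, and set Σ₁ = L₁L₁ᵀ and Σ₂ = L₂L₂ᵀ. Let U₁ be a real symmetric p₁×p₁ matrix and U₂ a real symmetric p₂×p₂ matrix. Define M = I_{p₂} ⊗ (L₁⁻¹U₁L₁⁻ᵀ) + (L₂⁻¹U₂L₂⁻ᵀ) ⊗ I_{p₁} and R = (L₂ ⊗ L₁)·(M)_{½}, where (N)_{½} = ⌊N⌋ + 𝔻(N)/2 denotes the strictly lower triangular part of N plus half its diagonal part, taking the triangular structure on the Kronecker index set in the lexicographic order. Then R is lower triangular with respect to the lexicographic order on the Kronecker index set, and (L₂ ⊗ L₁)·Rᵀ + R·(L₂ ⊗ L₁)ᵀ = U₂ ⊗ Σ₁ + Σ₂ ⊗ U₁. -/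
open Matrix
open scoped Kronecker

/-- Lexicographic strict order on the Kronecker index set. -/
def lexLt {p₁ p₂ : ℕ} (x y : Fin p₂ × Fin p₁) : Prop :=
  x.1 < y.1 ∨ (x.1 = y.1 ∧ x.2 < y.2)

instance {p₁ p₂ : ℕ} (x y : Fin p₂ × Fin p₁) : Decidable (lexLt x y) := by
  unfold lexLt; infer_instance

/-- `(N)_{½} = ⌊N⌋ + 𝔻(N)/2`: strictly lower triangular part (w.r.t. the
lexicographic order on the Kronecker index set) plus half the diagonal part. -/
noncomputable def halfPart {p₁ p₂ : ℕ} (N : Matrix (Fin p₂ × Fin p₁) (Fin p₂ × Fin p₁) ℝ) :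
    Matrix (Fin p₂ × Fin p₁) (Fin p₂ × Fin p₁) ℝ :=
  fun x y => if lexLt y x then N x y else if x = y then N x y / 2 else 0

theorem halfPart_add_transpose {p₁ p₂ : ℕ}
    (N : Matrix (Fin p₂ × Fin p₁) (Fin p₂ × Fin p₁) ℝ) (hN : Nᵀ = N) :
    (halfPart N)ᵀ + halfPart N = N := by
  ext x y
  have hs : N y x = N x y := congrFun (congrFun hN x) y
  simp only [Matrix.add_apply, Matrix.transpose_apply, halfPart]
  by_cases hxy : x = y
  · subst hxy
    simp [lexLt]
  · have hyx : ¬ y = x := fun h => hxy h.symm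
    by_cases h1 : lexLt x y
    · have h2 : ¬ lexLt y x := by
        unfold lexLt at *
        omega
      simp [h1, h2, hxy, hs]
    · have h2 : lexLt y x := by
        have h3 : ¬ (x.1 = y.1 ∧ x.2 = y.2) := fun h => hxy (Prod.ext h.1 h.2)
        unfold lexLt at *
        omega
      simp [h1, h2, hyx]

theorem isUnit_det_of_lower {p : ℕ} (L : Matrix (Fin p) (Fin p) ℝ)
    (htri : ∀ i j : Fin p, i < j → L i j = 0) (hdiag : ∀ i, 0 < L i i) : IsUnit L.det := by
  rw [Matrix.det_of_lowerTriangular L (fun i j h => htri i j h)]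
  exact (Finset.prod_pos fun i _ => hdiag i).ne'.isUnit

/-- the differential of the Cholesky square-root map on the
separable covariance manifold: with
`M = I ⊗ (L₁⁻¹U₁L₁⁻ᵀ) + (L₂⁻¹U₂L₂⁻ᵀ) ⊗ I` and `R = (L₂ ⊗ L₁)·(M)_{½}`,
`R` is lower triangular (lexicographic order) and solves
`(L₂⊗L₁)Rᵀ + R(L₂⊗L₁)ᵀ = U₂ ⊗ Σ₁ + Σ₂ ⊗ U₁`. -/
theorem chol_kronecker_differential
    (p₁ p₂ : ℕ)
    (L₁ : Matrix (Fin p₁) (Fin p₁) ℝ) (L₂ : Matrix (Fin p₂) (Fin p₂) ℝ)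
    (hL₁tri : ∀ i j : Fin p₁, i < j → L₁ i j = 0) (hL₁diag : ∀ i, 0 < L₁ i i)
    (hL₂tri : ∀ i j : Fin p₂, i < j → L₂ i j = 0) (hL₂diag : ∀ i, 0 < L₂ i i)
    (U₁ : Matrix (Fin p₁) (Fin p₁) ℝ) (hU₁ : U₁.IsSymm)
    (U₂ : Matrix (Fin p₂) (Fin p₂) ℝ) (hU₂ : U₂.IsSymm) :
    (∀ x y : Fin p₂ × Fin p₁, lexLt x y →
        ((L₂ ⊗ₖ L₁) *
          halfPart ((1 : Matrix (Fin p₂) (Fin p₂) ℝ) ⊗ₖ (L₁⁻¹ * U₁ * (L₁⁻¹)ᵀ) +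
            (L₂⁻¹ * U₂ * (L₂⁻¹)ᵀ) ⊗ₖ (1 : Matrix (Fin p₁) (Fin p₁) ℝ))) x y = 0) ∧
    (L₂ ⊗ₖ L₁) *
        ((L₂ ⊗ₖ L₁) *
          halfPart ((1 : Matrix (Fin p₂) (Fin p₂) ℝ) ⊗ₖ (L₁⁻¹ * U₁ * (L₁⁻¹)ᵀ) +
            (L₂⁻¹ * U₂ * (L₂⁻¹)ᵀ) ⊗ₖ (1 : Matrix (Fin p₁) (Fin p₁) ℝ)))ᵀ +
      ((L₂ ⊗ₖ L₁) *
          halfPart ((1 : Matrix (Fin p₂) (Fin p₂) ℝ) ⊗ₖ (L₁⁻¹ * U₁ * (L₁⁻¹)ᵀ) +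
            (L₂⁻¹ * U₂ * (L₂⁻¹)ᵀ) ⊗ₖ (1 : Matrix (Fin p₁) (Fin p₁) ℝ))) *
        (L₂ ⊗ₖ L₁)ᵀ
      = U₂ ⊗ₖ (L₁ * L₁ᵀ) + (L₂ * L₂ᵀ) ⊗ₖ U₁ := by
  have hd₁ := isUnit_det_of_lower L₁ hL₁tri hL₁diag
  have hd₂ := isUnit_det_of_lower L₂ hL₂tri hL₂diag
  have key : ∀ (p : ℕ) (L U : Matrix (Fin p) (Fin p) ℝ), IsUnit L.det →
      L * (L⁻¹ * U * (L⁻¹)ᵀ) * Lᵀ = U := by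
    intro p L U hd
    have h1 : L * L⁻¹ = 1 := Matrix.mul_nonsing_inv L hd
    have h2 : (L⁻¹)ᵀ * Lᵀ = 1 := by rw [← Matrix.transpose_mul, h1, Matrix.transpose_one]
    calc L * (L⁻¹ * U * (L⁻¹)ᵀ) * Lᵀ = (L * L⁻¹) * U * ((L⁻¹)ᵀ * Lᵀ) := by
          simp only [Matrix.mul_assoc]
      _ = U := by rw [h1, h2, Matrix.one_mul, Matrix.mul_one]
  have hk₁ := key p₁ L₁ U₁ hd₁
  have hk₂ := key p₂ L₂ U₂ hd₂
  have hs₁ : (L₁⁻¹ * U₁ * (L₁⁻¹)ᵀ)ᵀ = L₁⁻¹ * U₁ * (L₁⁻¹)ᵀ := by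
    rw [Matrix.transpose_mul, Matrix.transpose_mul, Matrix.transpose_transpose, hU₁.eq,
      Matrix.mul_assoc]
  have hs₂ : (L₂⁻¹ * U₂ * (L₂⁻¹)ᵀ)ᵀ = L₂⁻¹ * U₂ * (L₂⁻¹)ᵀ := by
    rw [Matrix.transpose_mul, Matrix.transpose_mul, Matrix.transpose_transpose, hU₂.eq,
      Matrix.mul_assoc]
  generalize L₁⁻¹ * U₁ * (L₁⁻¹)ᵀ = A₁ at *
  generalize L₂⁻¹ * U₂ * (L₂⁻¹)ᵀ = A₂ at *
  constructor
  · intro x y hxy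
    rw [Matrix.mul_apply]
    refine Finset.sum_eq_zero fun z _ => ?_
    by_cases h1 : x.1 < z.1
    · simp [Matrix.kroneckerMap_apply, hL₂tri _ _ h1]
    by_cases h2 : x.2 < z.2
    · simp [Matrix.kroneckerMap_apply, hL₁tri _ _ h2]
    have h3 : ¬ lexLt y z := by
      unfold lexLt at *
      omega
    have h4 : z ≠ y := by
      rintro rfl
      unfold lexLt at *
      omega
    simp [halfPart, h3, h4]
  · have hM : ((1 : Matrix (Fin p₂) (Fin p₂) ℝ) ⊗ₖ A₁ +
        A₂ ⊗ₖ (1 : Matrix (Fin p₁) (Fin p₁) ℝ))ᵀ =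
        (1 : Matrix (Fin p₂) (Fin p₂) ℝ) ⊗ₖ A₁ + A₂ ⊗ₖ (1 : Matrix (Fin p₁) (Fin p₁) ℝ) := by
      rw [Matrix.transpose_add, ← Matrix.kroneckerMap_transpose, ← Matrix.kroneckerMap_transpose,
        hs₁, hs₂, Matrix.transpose_one, Matrix.transpose_one]
    have hH := halfPart_add_transpose _ hM
    rw [Matrix.transpose_mul, ← Matrix.mul_assoc, ← Matrix.add_mul, ← Matrix.mul_add, hH,
      Matrix.mul_add, Matrix.add_mul, ← Matrix.kroneckerMap_transpose,
      ← Matrix.mul_kronecker_mul, ← Matrix.mul_kronecker_mul, ← Matrix.mul_kronecker_mul,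
      ← Matrix.mul_kronecker_mul, hk₁, hk₂, Matrix.mul_one, Matrix.mul_one, add_comm]
end

section
/- Let Σ₁ = Γ₁Λ₁Γ₁ᵀ and Σ₂ = Γ₂Λ₂Γ₂ᵀ be eigendecompositions of real positive definite matrices of sizes p₁ and p₂ respectively, where Γ₁, Γ₂ are orthogonal and Λ₁, Λ₂ are diagonal with positive diagonal entries, and let U₁, U₂ be real symmetric matrices of sizes p₁, p₂. Let Λ be the p×p matrix (p = p₁p₂, Kronecker indexing) with entries Λ((i,j),(i',j')) = sqrt((Λ₂)_{ii}·(Λ₁)_{jj}) + sqrt((Λ₂)_{i'i'}·(Λ₁)_{j'j'}), and let Λ⁻ be its entrywise reciprocal. Define R = (Γ₂ ⊗ Γ₁)·[Λ⁻ ∘ (Λ₂ ⊗ (Γ₁ᵀU₁Γ₁) + (Γ₂ᵀU₂Γ₂) ⊗ Λ₁)]·(Γ₂ ⊗ Γ₁)ᵀ, where ∘ denotes the Hadamard (entrywise) product. Then R is symmetric and, with the symmetric square roots S₁ = Γ₁Λ₁^{1/2}Γ₁ᵀ and S₂ = Γ₂Λ₂^{1/2}Γ₂ᵀ, it satisfies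 (S₂ ⊗ S₁)·R + R·(S₂ ⊗ S₁) = U₂ ⊗ Σ₁ + Σ₂ ⊗ U₁. -/
open Matrix
open scoped Kronecker

/-- the differential of the symmetric square-root map on the
separable covariance manifold as the solution of a Sylvester equation.  With
eigendecompositions `Σᵢ = Γᵢ Λᵢ Γᵢᵀ`, the matrix
`R = (Γ₂⊗Γ₁)·[Λ⁻ ∘ (Λ₂ ⊗ Γ₁ᵀU₁Γ₁ + Γ₂ᵀU₂Γ₂ ⊗ Λ₁)]·(Γ₂⊗Γ₁)ᵀ` is symmetric and
satisfies `(S₂⊗S₁)R + R(S₂⊗S₁) = U₂ ⊗ Σ₁ + Σ₂ ⊗ U₁` for the symmetric square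
roots `Sᵢ = Γᵢ Λᵢ^{1/2} Γᵢᵀ`. -/
theorem symmetric_sqrt_kronecker_differential
    (p₁ p₂ : ℕ)
    (Γ₁ : Matrix (Fin p₁) (Fin p₁) ℝ) (Γ₂ : Matrix (Fin p₂) (Fin p₂) ℝ)
    (hΓ₁ : Γ₁ᵀ * Γ₁ = 1 ∧ Γ₁ * Γ₁ᵀ = 1) (hΓ₂ : Γ₂ᵀ * Γ₂ = 1 ∧ Γ₂ * Γ₂ᵀ = 1)
    (d₁ : Fin p₁ → ℝ) (d₂ : Fin p₂ → ℝ)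
    (hd₁ : ∀ j, 0 < d₁ j) (hd₂ : ∀ i, 0 < d₂ i)
    (U₁ : Matrix (Fin p₁) (Fin p₁) ℝ) (hU₁ : U₁.IsSymm)
    (U₂ : Matrix (Fin p₂) (Fin p₂) ℝ) (hU₂ : U₂.IsSymm)
    (R : Matrix (Fin p₂ × Fin p₁) (Fin p₂ × Fin p₁) ℝ)
    (hR : R = (Γ₂ ⊗ₖ Γ₁) *
        (Matrix.hadamard
          (fun x y => (Real.sqrt (d₂ x.1 * d₁ x.2) + Real.sqrt (d₂ y.1 * d₁ y.2))⁻¹)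
          ((Matrix.diagonal d₂) ⊗ₖ (Γ₁ᵀ * U₁ * Γ₁) +
            (Γ₂ᵀ * U₂ * Γ₂) ⊗ₖ (Matrix.diagonal d₁))) *
        (Γ₂ ⊗ₖ Γ₁)ᵀ) :
    R.IsSymm ∧
    ((Γ₂ * Matrix.diagonal (fun i => Real.sqrt (d₂ i)) * Γ₂ᵀ) ⊗ₖ
        (Γ₁ * Matrix.diagonal (fun j => Real.sqrt (d₁ j)) * Γ₁ᵀ)) * R +
      R * ((Γ₂ * Matrix.diagonal (fun i => Real.sqrt (d₂ i)) * Γ₂ᵀ) ⊗ₖ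
        (Γ₁ * Matrix.diagonal (fun j => Real.sqrt (d₁ j)) * Γ₁ᵀ))
      = U₂ ⊗ₖ (Γ₁ * Matrix.diagonal d₁ * Γ₁ᵀ) +
        (Γ₂ * Matrix.diagonal d₂ * Γ₂ᵀ) ⊗ₖ U₁ := by
  obtain ⟨h1, h1'⟩ := hΓ₁
  obtain ⟨h2, h2'⟩ := hΓ₂
  set M : Matrix (Fin p₂ × Fin p₁) (Fin p₂ × Fin p₁) ℝ :=
    (Matrix.diagonal d₂) ⊗ₖ (Γ₁ᵀ * U₁ * Γ₁) +
      (Γ₂ᵀ * U₂ * Γ₂) ⊗ₖ (Matrix.diagonal d₁) with hM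
  set H : Matrix (Fin p₂ × Fin p₁) (Fin p₂ × Fin p₁) ℝ := Matrix.hadamard
    (fun x y => (Real.sqrt (d₂ x.1 * d₁ x.2) + Real.sqrt (d₂ y.1 * d₁ y.2))⁻¹) M with hH
  set G : Matrix (Fin p₂ × Fin p₁) (Fin p₂ × Fin p₁) ℝ := Γ₂ ⊗ₖ Γ₁ with hG
  set D : Matrix (Fin p₂ × Fin p₁) (Fin p₂ × Fin p₁) ℝ :=
    Matrix.diagonal (fun x => Real.sqrt (d₂ x.1 * d₁ x.2)) with hD
  have hGt : Gᵀ = Γ₂ᵀ ⊗ₖ Γ₁ᵀ := by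
    ext x y; rfl
  have hGG : Gᵀ * G = 1 := by
    rw [hGt, hG, ← Matrix.mul_kronecker_mul, h1, h2, Matrix.one_kronecker_one]
  have hMs : Mᵀ = M := by
    have a1 : (Γ₁ᵀ * U₁ * Γ₁)ᵀ = Γ₁ᵀ * U₁ * Γ₁ := by
      simp [Matrix.transpose_mul, hU₁.eq, Matrix.mul_assoc]
    have a2 : (Γ₂ᵀ * U₂ * Γ₂)ᵀ = Γ₂ᵀ * U₂ * Γ₂ := by
      simp [Matrix.transpose_mul, hU₂.eq, Matrix.mul_assoc]
    have e : Mᵀ = (Matrix.diagonal d₂)ᵀ ⊗ₖ (Γ₁ᵀ * U₁ * Γ₁)ᵀ +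
      (Γ₂ᵀ * U₂ * Γ₂)ᵀ ⊗ₖ (Matrix.diagonal d₁)ᵀ := by
      ext x y; rfl
    rw [e, a1, a2, Matrix.diagonal_transpose, Matrix.diagonal_transpose]
  have hHa : ∀ x y, H x y =
      (Real.sqrt (d₂ x.1 * d₁ x.2) + Real.sqrt (d₂ y.1 * d₁ y.2))⁻¹ * M x y :=
    fun x y => rfl
  have hHs : Hᵀ = H := by
    ext x y
    have e : M y x = M x y := congrFun (congrFun hMs x) y
    rw [Matrix.transpose_apply, hHa, hHa, e, add_comm]
  have hS : (Γ₂ * Matrix.diagonal (fun i => Real.sqrt (d₂ i)) * Γ₂ᵀ) ⊗ₖ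
        (Γ₁ * Matrix.diagonal (fun j => Real.sqrt (d₁ j)) * Γ₁ᵀ) = G * D * Gᵀ := by
    rw [Matrix.mul_kronecker_mul, Matrix.mul_kronecker_mul, ← hGt, ← hG,
      Matrix.diagonal_kronecker_diagonal]
    simp only [hD, Real.sqrt_mul (hd₂ _).le]
  have hDH : D * H + H * D = M := by
    ext x y
    rw [Matrix.add_apply, hD, Matrix.diagonal_mul, Matrix.mul_diagonal, hHa]
    have px := Real.sqrt_pos.2 (mul_pos (hd₂ x.1) (hd₁ x.2))
    have py := Real.sqrt_pos.2 (mul_pos (hd₂ y.1) (hd₁ y.2))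
    field_simp
  have hGM : G * M * Gᵀ = U₂ ⊗ₖ (Γ₁ * Matrix.diagonal d₁ * Γ₁ᵀ) +
        (Γ₂ * Matrix.diagonal d₂ * Γ₂ᵀ) ⊗ₖ U₁ := by
    have b1 : Γ₁ * (Γ₁ᵀ * U₁ * Γ₁) * Γ₁ᵀ = U₁ := by
      calc _ = (Γ₁ * Γ₁ᵀ) * U₁ * (Γ₁ * Γ₁ᵀ) := by simp only [Matrix.mul_assoc]
        _ = U₁ := by simp [h1']
    have b2 : Γ₂ * (Γ₂ᵀ * U₂ * Γ₂) * Γ₂ᵀ = U₂ := by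
      calc _ = (Γ₂ * Γ₂ᵀ) * U₂ * (Γ₂ * Γ₂ᵀ) := by simp only [Matrix.mul_assoc]
        _ = U₂ := by simp [h2']
    rw [hM, hGt, hG, Matrix.mul_add, Matrix.add_mul]
    simp only [← Matrix.mul_kronecker_mul]
    rw [b1, b2, add_comm]
  refine ⟨?_, ?_⟩
  · rw [Matrix.IsSymm, hR, Matrix.transpose_mul, Matrix.transpose_mul,
      Matrix.transpose_transpose, hHs, Matrix.mul_assoc]
  · rw [hS, ← hGM, ← hDH, hR]
    have c1 : G * D * Gᵀ * (G * H * Gᵀ) = G * (D * H) * Gᵀ := by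
      calc _ = G * D * (Gᵀ * G) * H * Gᵀ := by simp only [Matrix.mul_assoc]
        _ = _ := by rw [hGG]; simp only [Matrix.mul_assoc, Matrix.one_mul]
    have c2 : G * H * Gᵀ * (G * D * Gᵀ) = G * (H * D) * Gᵀ := by
      calc _ = G * H * (Gᵀ * G) * D * Gᵀ := by simp only [Matrix.mul_assoc]
        _ = _ := by rw [hGG]; simp only [Matrix.mul_assoc, Matrix.one_mul]
    rw [c1, c2, Matrix.mul_add, Matrix.add_mul]
end

section
/- Let p₁, p₂ ≥ 2 and p = p₁p₂. For a real symmetric p×p matrix V, define G(V) = V − (1/p₂)·(I_{p₂} ⊗ tr₁(V)) − (1/p₁)·(tr₂(V) ⊗ I_{p₁}) + (tr(V)/p)·I_p. Then: (i) tr₁(G(V)) = 0 and tr₂(G(V)) = 0; and (ii) for every real symmetric p×p matrix W with tr₁(W) = 0 and tr₂(W) = 0, one has tr(Wᵀ·(V − G(V))) = 0. Hence G is the Euclidean orthogonal projection of the space of symmetric p×p matrices onto the subspace {W symmetric : tr₁(W) = 0, tr₂(W) = 0}. -/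
open Matrix
open scoped Kronecker

/-- The orthogonal projection onto the subspace of symmetric matrices with
vanishing partial traces:
`G(V) = V − (1/p₂)(I ⊗ tr₁(V)) − (1/p₁)(tr₂(V) ⊗ I) + (tr(V)/p)·I`. -/
noncomputable def coreProj (p₁ p₂ : ℕ)
    (V : Matrix (Fin p₂ × Fin p₁) (Fin p₂ × Fin p₁) ℝ) :
    Matrix (Fin p₂ × Fin p₁) (Fin p₂ × Fin p₁) ℝ :=
  V - ((1 : ℝ) / p₂) • ((1 : Matrix (Fin p₂) (Fin p₂) ℝ) ⊗ₖ partialTrace1 V)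
    - ((1 : ℝ) / p₁) • (partialTrace2 V ⊗ₖ (1 : Matrix (Fin p₁) (Fin p₁) ℝ))
    + (V.trace / (p₁ * p₂ : ℝ)) • (1 : Matrix (Fin p₂ × Fin p₁) (Fin p₂ × Fin p₁) ℝ)

theorem aux_tr_one_kron {p₁ p₂ : ℕ} (W : Matrix (Fin p₂ × Fin p₁) (Fin p₂ × Fin p₁) ℝ)
    (A : Matrix (Fin p₁) (Fin p₁) ℝ) :
    (Wᵀ * ((1 : Matrix (Fin p₂) (Fin p₂) ℝ) ⊗ₖ A)).trace = ((partialTrace1 W)ᵀ * A).trace := by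
  simp only [Matrix.trace, Matrix.diag_apply, Matrix.mul_apply, Matrix.transpose_apply,
    Matrix.kroneckerMap_apply, partialTrace1, Fintype.sum_prod_type, Matrix.one_apply,
    Finset.sum_mul]
  rw [Finset.sum_comm]
  refine Finset.sum_congr rfl fun j _ => ?_
  rw [Finset.sum_comm (s := (Finset.univ : Finset (Fin p₁)))]
  refine Finset.sum_congr rfl fun i _ => ?_
  rw [Finset.sum_comm]
  simp

theorem aux_tr_kron_one {p₁ p₂ : ℕ} (W : Matrix (Fin p₂ × Fin p₁) (Fin p₂ × Fin p₁) ℝ)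
    (A : Matrix (Fin p₂) (Fin p₂) ℝ) :
    (Wᵀ * (A ⊗ₖ (1 : Matrix (Fin p₁) (Fin p₁) ℝ))).trace = ((partialTrace2 W)ᵀ * A).trace := by
  simp only [Matrix.trace, Matrix.diag_apply, Matrix.mul_apply, Matrix.transpose_apply,
    Matrix.kroneckerMap_apply, partialTrace2, Fintype.sum_prod_type, Matrix.one_apply,
    Finset.sum_mul]
  refine Finset.sum_congr rfl fun i _ => ?_
  rw [Finset.sum_comm]
  refine Finset.sum_congr rfl fun i' _ => ?_
  simp

/-- `G` is the Euclidean orthogonal projection of the space of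
symmetric matrices onto `{W symmetric : tr₁(W) = 0, tr₂(W) = 0}`. -/
theorem coreProj_is_orthogonal_projection
    (p₁ p₂ : ℕ) (hp₁ : 2 ≤ p₁) (hp₂ : 2 ≤ p₂)
    (V : Matrix (Fin p₂ × Fin p₁) (Fin p₂ × Fin p₁) ℝ) (hV : V.IsSymm) :
    partialTrace1 (coreProj p₁ p₂ V) = 0 ∧
    partialTrace2 (coreProj p₁ p₂ V) = 0 ∧
    (∀ W : Matrix (Fin p₂ × Fin p₁) (Fin p₂ × Fin p₁) ℝ,
      W.IsSymm → partialTrace1 W = 0 → partialTrace2 W = 0 →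
        (Wᵀ * (V - coreProj p₁ p₂ V)).trace = 0) := by
  have h1 : (p₁ : ℝ) ≠ 0 := by positivity
  have h2 : (p₂ : ℝ) ≠ 0 := by positivity
  refine ⟨?_, ?_, ?_⟩
  · ext j j'
    have ht : V.trace = ∑ i : Fin p₂, partialTrace2 V i i := by
      simp [Matrix.trace, partialTrace2, Fintype.sum_prod_type]
    have hd : ∑ i : Fin p₂, V (i, j) (i, j') = partialTrace1 V j j' := rfl
    change ∑ i : Fin p₂, coreProj p₁ p₂ V (i, j) (i, j') = 0
    simp only [coreProj, Matrix.add_apply, Matrix.sub_apply, Matrix.smul_apply,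
      Matrix.kroneckerMap_apply, smul_eq_mul, Finset.sum_add_distrib, Finset.sum_sub_distrib, hd,
      ← Finset.mul_sum, ← Finset.sum_mul, ← ht]
    by_cases h : j = j'
    · subst h
      simp
      field_simp
      rw [ht]
      ring
    · simp [Matrix.one_apply, h]
      field_simp
      ring
  · ext i i'
    have ht : V.trace = ∑ j : Fin p₁, partialTrace1 V j j := by
      simp only [Matrix.trace, partialTrace1, Fintype.sum_prod_type, Matrix.diag_apply]
      rw [Finset.sum_comm]
    have hd : ∑ j : Fin p₁, V (i, j) (i', j) = partialTrace2 V i i' := rfl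
    change ∑ j : Fin p₁, coreProj p₁ p₂ V (i, j) (i', j) = 0
    simp only [coreProj, Matrix.add_apply, Matrix.sub_apply, Matrix.smul_apply,
      Matrix.kroneckerMap_apply, smul_eq_mul, Finset.sum_add_distrib, Finset.sum_sub_distrib, hd,
      ← Finset.mul_sum, ← Finset.sum_mul, ← ht]
    by_cases h : i = i'
    · subst h
      simp
      field_simp
      rw [ht]
      ring
    · simp [Matrix.one_apply, h]
      field_simp
      ring
  · intro W _ hW1 hW2
    have e : V - coreProj p₁ p₂ V =
        ((1 : ℝ) / p₂) • ((1 : Matrix (Fin p₂) (Fin p₂) ℝ) ⊗ₖ partialTrace1 V)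
        + ((1 : ℝ) / p₁) • (partialTrace2 V ⊗ₖ (1 : Matrix (Fin p₁) (Fin p₁) ℝ))
        - (V.trace / (p₁ * p₂ : ℝ)) •
          ((1 : Matrix (Fin p₂) (Fin p₂) ℝ) ⊗ₖ (1 : Matrix (Fin p₁) (Fin p₁) ℝ)) := by
      rw [Matrix.one_kronecker_one]
      unfold coreProj
      abel
    rw [e, Matrix.mul_sub, Matrix.mul_add, Matrix.trace_sub, Matrix.trace_add]
    simp only [Matrix.mul_smul, Matrix.trace_smul, aux_tr_one_kron, aux_tr_kron_one, hW1, hW2]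
    simp
end

section
/- Let p and r be integers with 1 ≤ r < p. Suppose A₁ and A₂ are real p×r matrices of rank r and λ₁, λ₂ ∈ (0,1) are real numbers satisfying (1−λ₁)·A₁A₁ᵀ + λ₁·I_p = (1−λ₂)·A₂A₂ᵀ + λ₂·I_p. Then λ₁ = λ₂ and there exists an r×r real orthogonal matrix O such that A₁ = A₂·O. -/
open Matrix

theorem pi_aux_le
    (p r : ℕ) (hrp : r < p)
    (A₁ A₂ : Matrix (Fin p) (Fin r) ℝ)
    (lam₁ lam₂ : ℝ) (hlam₂ : lam₂ ≤ 1)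
    (h : (1 - lam₁) • (A₁ * A₁ᵀ) + lam₁ • (1 : Matrix (Fin p) (Fin p) ℝ)
       = (1 - lam₂) • (A₂ * A₂ᵀ) + lam₂ • (1 : Matrix (Fin p) (Fin p) ℝ)) :
    lam₂ ≤ lam₁ := by
  obtain ⟨v, hv, hv0⟩ : ∃ v : Fin p → ℝ, A₁ᵀ *ᵥ v = 0 ∧ v ≠ 0 := by
    have hk : LinearMap.ker A₁ᵀ.mulVecLin ≠ ⊥ :=
      LinearMap.ker_ne_bot_of_finrank_lt (by simpa using hrp)
    obtain ⟨v, h1, h2⟩ := (Submodule.ne_bot_iff _).1 hk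
    exact ⟨v, LinearMap.mem_ker.1 h1, h2⟩
  have key := congrArg (fun M => v ⬝ᵥ (M *ᵥ v)) h
  have e : v ⬝ᵥ (A₂ *ᵥ (A₂ᵀ *ᵥ v)) = (A₂ᵀ *ᵥ v) ⬝ᵥ (A₂ᵀ *ᵥ v) := by
    rw [dotProduct_mulVec, mulVec_transpose]
  simp only [add_mulVec, smul_mulVec, ← mulVec_mulVec, hv, mulVec_zero, smul_zero, zero_add,
    one_mulVec, dotProduct_add, dotProduct_smul, smul_eq_mul, e] at key
  have h1 : 0 ≤ (A₂ᵀ *ᵥ v) ⬝ᵥ (A₂ᵀ *ᵥ v) :=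
    Finset.sum_nonneg fun i _ => mul_self_nonneg _
  have h2 : 0 < v ⬝ᵥ v :=
    lt_of_le_of_ne (Finset.sum_nonneg fun i _ => mul_self_nonneg _)
      (fun h => hv0 (dotProduct_self_eq_zero.1 h.symm))
  have h3 := mul_nonneg (sub_nonneg.2 hlam₂) h1
  by_contra hc
  push Not at hc
  nlinarith [mul_lt_mul_of_pos_right hc h2]

/-- identifiability of the partial-isotropy parameterization:
if `(1−λ₁)A₁A₁ᵀ + λ₁I = (1−λ₂)A₂A₂ᵀ + λ₂I` with `A₁, A₂` of full column rank
`r < p` and `λ₁, λ₂ ∈ (0,1)`, then `λ₁ = λ₂` and `A₁ = A₂·O` for some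
orthogonal `O`. -/
theorem partial_isotropy_identifiability
    (p r : ℕ) (hr : 1 ≤ r) (hrp : r < p)
    (A₁ A₂ : Matrix (Fin p) (Fin r) ℝ)
    (hA₁ : A₁.rank = r) (hA₂ : A₂.rank = r)
    (lam₁ lam₂ : ℝ) (hlam₁ : lam₁ ∈ Set.Ioo (0 : ℝ) 1) (hlam₂ : lam₂ ∈ Set.Ioo (0 : ℝ) 1)
    (h : (1 - lam₁) • (A₁ * A₁ᵀ) + lam₁ • (1 : Matrix (Fin p) (Fin p) ℝ)
       = (1 - lam₂) • (A₂ * A₂ᵀ) + lam₂ • (1 : Matrix (Fin p) (Fin p) ℝ)) :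
    lam₁ = lam₂ ∧
    ∃ O : Matrix (Fin r) (Fin r) ℝ, Oᵀ * O = 1 ∧ O * Oᵀ = 1 ∧ A₁ = A₂ * O := by
  have hl : lam₁ = lam₂ := le_antisymm
    (pi_aux_le p r hrp A₂ A₁ lam₂ lam₁ hlam₁.2.le h.symm)
    (pi_aux_le p r hrp A₁ A₂ lam₁ lam₂ hlam₂.2.le h)
  subst hl
  have hA : A₁ * A₁ᵀ = A₂ * A₂ᵀ :=
    smul_right_injective _ (sub_pos.2 hlam₁.2).ne' (add_right_cancel h)
  have hu : IsUnit (A₁ᵀ * A₁) := by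
    rw [← mulVec_injective_iff_isUnit, ← coe_mulVecLin, ← LinearMap.ker_eq_bot,
      ker_mulVecLin_transpose_mul_self]
    have h1 := A₁.mulVecLin.finrank_range_add_finrank_ker
    have h2 : Module.finrank ℝ (LinearMap.range A₁.mulVecLin) = r := hA₁
    rw [h2, Module.finrank_fin_fun] at h1
    exact Submodule.finrank_eq_zero.1 (by omega)
  have hd := (isUnit_iff_isUnit_det _).1 hu
  have hO : (A₂ᵀ * A₁ * (A₁ᵀ * A₁)⁻¹)ᵀ * (A₂ᵀ * A₁ * (A₁ᵀ * A₁)⁻¹) = 1 := by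
    have ht : ((A₁ᵀ * A₁)⁻¹)ᵀ = (A₁ᵀ * A₁)⁻¹ := by
      rw [transpose_nonsing_inv]; simp
    calc _ = (A₁ᵀ * A₁)⁻¹ * (A₁ᵀ * (A₂ * A₂ᵀ) * A₁) * (A₁ᵀ * A₁)⁻¹ := by
          rw [transpose_mul, ht]; simp only [transpose_mul, transpose_transpose, Matrix.mul_assoc]
      _ = ((A₁ᵀ * A₁)⁻¹ * (A₁ᵀ * A₁)) * ((A₁ᵀ * A₁) * (A₁ᵀ * A₁)⁻¹) := by
          rw [← hA]; simp only [Matrix.mul_assoc]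
      _ = 1 := by rw [nonsing_inv_mul _ hd, mul_nonsing_inv _ hd, Matrix.one_mul]
  refine ⟨rfl, _, hO, mul_eq_one_comm.1 hO, ?_⟩
  calc A₁ = A₁ * ((A₁ᵀ * A₁) * (A₁ᵀ * A₁)⁻¹) := by rw [mul_nonsing_inv _ hd, Matrix.mul_one]
    _ = (A₁ * A₁ᵀ) * (A₁ * (A₁ᵀ * A₁)⁻¹) := by simp only [Matrix.mul_assoc]
    _ = _ := by rw [hA]; simp only [Matrix.mul_assoc]
end
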